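/- arXiv:2005.11191 — 3 statements merged into one kernel-verified Lean document; each statement's English description precedes it below -/
import Mathlib

section
/- Chain rule for the Kullback–Leibler divergence (Property 1): Let (Y, μ) and (Z, ν) be σ-finite measure spaces, and let φ and g be pdfs on the product space (Y × Z, μ ⊗ ν) with φ = 0 (μ⊗ν)-a.e. on {g = 0}. Define the marginals φ_Y(y) := ∫ φ(y,z) dν(z) and g_Y(y) := ∫ g(y,z) dν(z), and the conditionals φ(z|y) := φ(y,z)/φ_Y(y) on {φ_Y > 0} (and 0 elsewhere), g(z|y) := g(y,z)/g_Y(y) on {g_Y > 0} (and 0 elsewhere). Assume (y,z) ↦ φ(y,z) log(φ(y,z)/g(y,z)) and y ↦ φ_Y(y) log(φ_Y(y)/g_Y(y)) are integrable. Then ∫∫ φ(y,z) log(φ(y,z)/g(y,z)) dν(z) dμ(y) = ∫ φ_Y(y) log(φ_Y(y)/g_Y(y)) dμ(y) + ∫ φ_Y(y) ( ∫ φ(z|y) log(φ(z|y)/g(z|y)) dν(z) ) dμ(y). -/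
open MeasureTheory

/-- Rescaling two functions by their total masses splits off the divergence of the masses. -/
theorem integral_mul_log_div_eq_add_normalized {Z : Type*} [MeasurableSpace Z] {ν : Measure Z}
    {f h : Z → ℝ} (hf : Integrable f ν) (hh : Integrable h ν)
    (hf_nonneg : 0 ≤ᵐ[ν] f) (hh_nonneg : 0 ≤ᵐ[ν] h)
    (habs : ∀ᵐ z ∂ν, h z = 0 → f z = 0)
    (hint : Integrable (fun z => f z * Real.log (f z / h z)) ν)
    {a b : ℝ} (ha : a = ∫ z, f z ∂ν) (hb : b = ∫ z, h z ∂ν) :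
    ∫ z, f z * Real.log (f z / h z) ∂ν = a * Real.log (a / b) +
      a * ∫ z, (if 0 < a then f z / a else 0) *
        Real.log ((if 0 < a then f z / a else 0) / (if 0 < b then h z / b else 0)) ∂ν := by
  have ha_nonneg : 0 ≤ a := ha ▸ integral_nonneg_of_ae hf_nonneg
  have hb_nonneg : 0 ≤ b := hb ▸ integral_nonneg_of_ae hh_nonneg
  rcases ha_nonneg.eq_or_lt with ha_zero | ha_pos
  · have hf_zero : f =ᵐ[ν] 0 :=
      (integral_eq_zero_iff_of_nonneg_ae hf_nonneg hf).1 (ha.symm.trans ha_zero.symm)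
    rw [← ha_zero, zero_mul, zero_mul, add_zero]
    refine integral_eq_zero_of_ae ?_
    filter_upwards [hf_zero] with z hz
    simp [hz]
  have hb_pos : 0 < b := by
    refine hb_nonneg.lt_of_ne fun hb_zero => ha_pos.ne' ?_
    have hh_zero : h =ᵐ[ν] 0 :=
      (integral_eq_zero_iff_of_nonneg_ae hh_nonneg hh).1 (hb.symm.trans hb_zero.symm)
    rw [ha]
    refine integral_eq_zero_of_ae ?_
    filter_upwards [hh_zero, habs] with z hz hz_abs using hz_abs hz
  have hcond : ∀ᵐ z ∂ν, f z / a * Real.log (f z / a / (h z / b)) =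
      a⁻¹ * (f z * Real.log (f z / h z)) - a⁻¹ * Real.log (a / b) * f z := by
    filter_upwards [habs] with z hz
    by_cases hfz : f z = 0
    · simp [hfz]
    have hhz : h z ≠ 0 := fun h0 => hfz (hz h0)
    rw [div_div_div_comm, Real.log_div (div_ne_zero hfz hhz) (div_pos ha_pos hb_pos).ne']
    ring
  simp only [if_pos ha_pos, if_pos hb_pos]
  rw [integral_congr_ae hcond, integral_sub (hint.const_mul _) (hf.const_mul _),
    integral_const_mul, integral_const_mul, ← ha]
  field_simp
  ring

/-- Chain rule for the Kullback–Leibler divergence (Property 1). -/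
theorem kl_chain_rule
    {Y Z : Type*} [MeasurableSpace Y] [MeasurableSpace Z]
    (μ : Measure Y) (ν : Measure Z) [SigmaFinite μ] [SigmaFinite ν]
    (φ g : Y × Z → ℝ)
    -- φ is a pdf on the product space
    (hφ_meas : Measurable φ) (hφ_nonneg : ∀ᵐ p ∂(μ.prod ν), 0 ≤ φ p)
    (hφ_one : ∫ p, φ p ∂(μ.prod ν) = 1)
    -- g is a pdf on the product space
    (hg_meas : Measurable g) (hg_nonneg : ∀ᵐ p ∂(μ.prod ν), 0 ≤ g p)
    (hg_one : ∫ p, g p ∂(μ.prod ν) = 1)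
    -- φ = 0 a.e. on {g = 0}
    (habs : ∀ᵐ p ∂(μ.prod ν), g p = 0 → φ p = 0)
    -- marginals
    (φY gY : Y → ℝ)
    (hφY : ∀ y, φY y = ∫ z, φ (y, z) ∂ν)
    (hgY : ∀ y, gY y = ∫ z, g (y, z) ∂ν)
    -- conditionals
    (φc gc : Y → Z → ℝ)
    (hφc : ∀ y z, φc y z = if 0 < φY y then φ (y, z) / φY y else 0)
    (hgc : ∀ y z, gc y z = if 0 < gY y then g (y, z) / gY y else 0)
    -- integrability assumptions
    (hint_joint : Integrable (fun p => φ p * Real.log (φ p / g p)) (μ.prod ν))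
    (hint_marg : Integrable (fun y => φY y * Real.log (φY y / gY y)) μ) :
    ∫ y, ∫ z, φ (y, z) * Real.log (φ (y, z) / g (y, z)) ∂ν ∂μ
      = (∫ y, φY y * Real.log (φY y / gY y) ∂μ)
        + ∫ y, φY y * ∫ z, φc y z * Real.log (φc y z / gc y z) ∂ν ∂μ := by
  have hφ : Integrable φ (μ.prod ν) := Integrable.of_integral_ne_zero (by simp [hφ_one])
  have hg : Integrable g (μ.prod ν) := Integrable.of_integral_ne_zero (by simp [hg_one])
  have hfiber : ∀ᵐ y ∂μ, φY y * ∫ z, φc y z * Real.log (φc y z / gc y z) ∂ν =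
      (∫ z, φ (y, z) * Real.log (φ (y, z) / g (y, z)) ∂ν) -
        φY y * Real.log (φY y / gY y) := by
    filter_upwards [hφ.prod_right_ae, hg.prod_right_ae, hint_joint.prod_right_ae,
      Measure.ae_ae_of_ae_prod hφ_nonneg, Measure.ae_ae_of_ae_prod hg_nonneg,
      Measure.ae_ae_of_ae_prod habs] with y hφy hgy hinty hφy_nonneg hgy_nonneg habsy
    simp only [hφc, hgc]
    exact eq_sub_of_add_eq' (integral_mul_log_div_eq_add_normalized hφy hgy hφy_nonneg
      hgy_nonneg habsy hinty (hφY y) (hgY y)).symm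
  rw [integral_congr_ae hfiber, integral_sub hint_joint.integral_prod_left hint_marg]
  ring
end

section
/- Value of the constrained minimum (Lemma 1, part (R2)): In the constrained KL-minimization setup, suppose λ = (λ_0, λ_1, …, λ_m) ∈ ℝ^{m+1} satisfies λ_j ≥ 0 for every j ∈ I, the function f* := g · exp( −(1 + α + Σ_{j=0}^{m} λ_j h_j) ) is a feasible pdf, and λ_j · (∫ f* h_j dμ − H_j) = 0 for every j ∈ I. Then, assuming f* log(f*/g) and f*·α are integrable, L(f*) = −(1 + Σ_{j=0}^{m} λ_j H_j); in particular, since λ_j = 0 for every inactive inequality index, L(f*) = −(1 + Σ_{j ∈ I_a} λ_j H_j), where I_a := E_0 ∪ { j ∈ I : ∫ f* h_j dμ = H_j } is the active index set. -/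
open MeasureTheory

/-- A probability density function on a measure space. -/
def IsPdf {Ω : Type*} [MeasurableSpace Ω] (μ : Measure Ω) (f : Ω → ℝ) : Prop :=
  Measurable f ∧ (∀ᵐ z ∂μ, 0 ≤ f z) ∧ ∫ z, f z ∂μ = 1

/-- Feasibility for the constrained KL-minimization problem: the equality
constraints (indices `0, …, ne`) and inequality constraints
(indices `ne+1, …, ne+nl`) hold, all the integrals existing. -/
def Feasible {Ω : Type*} [MeasurableSpace Ω] (μ : Measure Ω)
    (h : ℕ → Ω → ℝ) (H : ℕ → ℝ) (ne nl : ℕ) (f : Ω → ℝ) : Prop :=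
  (∀ j ≤ ne, Integrable (fun z => f z * h j z) μ ∧ ∫ z, f z * h j z ∂μ = H j) ∧
  (∀ j, ne < j → j ≤ ne + nl →
    Integrable (fun z => f z * h j z) μ ∧ ∫ z, f z * h j z ∂μ ≤ H j)

open scoped Classical in
/-- Value of the constrained minimum (Lemma 1, part (R2)). -/
theorem tilted_density_value
    {Ω : Type*} [MeasurableSpace Ω] (μ : Measure Ω) [SigmaFinite μ]
    (g : Ω → ℝ) (hg : IsPdf μ g)
    (α : Ω → ℝ) (hα : Measurable α)
    (ne nl : ℕ)
    (h : ℕ → Ω → ℝ) (H : ℕ → ℝ)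
    (hh0 : h 0 = fun _ => 1) (hH0 : H 0 = 1)
    (hh_meas : ∀ j ≤ ne + nl, Measurable (h j))
    (lam : ℕ → ℝ)
    (hlam_nonneg : ∀ j, ne < j → j ≤ ne + nl → 0 ≤ lam j)
    (fstar : Ω → ℝ)
    (hfstar : fstar = fun z =>
      g z * Real.exp (-(1 + α z + ∑ j ∈ Finset.range (ne + nl + 1), lam j * h j z)))
    (hfstar_pdf : IsPdf μ fstar)
    (hfstar_feas : Feasible μ h H ne nl fstar)
    -- complementary slackness
    (hslack : ∀ j, ne < j → j ≤ ne + nl →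
      lam j * ((∫ z, fstar z * h j z ∂μ) - H j) = 0)
    -- integrability of the cost of fstar
    (hfstar_int1 : Integrable (fun z => fstar z * Real.log (fstar z / g z)) μ)
    (hfstar_int2 : Integrable (fun z => fstar z * α z) μ) :
    ((∫ z, fstar z * Real.log (fstar z / g z) ∂μ) + (∫ z, fstar z * α z ∂μ)
        = -(1 + ∑ j ∈ Finset.range (ne + nl + 1), lam j * H j))
    ∧ (∫ z, fstar z * Real.log (fstar z / g z) ∂μ) + (∫ z, fstar z * α z ∂μ)
        = -(1 + ∑ j ∈ (Finset.range (ne + nl + 1)).filter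
              (fun j => j ≤ ne ∨ (ne < j ∧ (∫ z, fstar z * h j z ∂μ) = H j)),
            lam j * H j) := by
  have hint : ∀ j ∈ Finset.range (ne + nl + 1), Integrable (fun z => fstar z * h j z) μ := by
    intro j hj
    have hj' : j ≤ ne + nl := Nat.lt_succ_iff.mp (Finset.mem_range.mp hj)
    rcases le_or_gt j ne with hle | hlt
    · exact (hfstar_feas.1 j hle).1
    · exact (hfstar_feas.2 j hlt hj').1
  have hslack' : ∀ j ∈ Finset.range (ne + nl + 1),
      lam j * ∫ z, fstar z * h j z ∂μ = lam j * H j := by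
    intro j hj
    have hj' : j ≤ ne + nl := Nat.lt_succ_iff.mp (Finset.mem_range.mp hj)
    rcases le_or_gt j ne with hle | hlt
    · rw [(hfstar_feas.1 j hle).2]
    · linarith [hslack j hlt hj']
  have hf_int : Integrable fstar μ := by
    simpa [hh0] using hint 0 (by simp)
  have hpointwise : ∀ z, fstar z * Real.log (fstar z / g z) + fstar z * α z
      = -(fstar z + ∑ j ∈ Finset.range (ne + nl + 1), lam j * (fstar z * h j z)) := by
    intro z
    have hsum : ∑ j ∈ Finset.range (ne + nl + 1), lam j * (fstar z * h j z)
        = fstar z * ∑ j ∈ Finset.range (ne + nl + 1), lam j * h j z := by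
      rw [Finset.mul_sum]
      exact Finset.sum_congr rfl fun j _ => by ring
    rw [hsum]
    have hz := congrFun hfstar z
    rcases eq_or_ne (g z) 0 with h0 | h0
    · have hf0 : fstar z = 0 := by simp [hz, h0]
      simp [hf0]
    · have hlog : Real.log (fstar z / g z)
          = -(1 + α z + ∑ j ∈ Finset.range (ne + nl + 1), lam j * h j z) := by
        rw [hz, mul_div_cancel_left₀ _ h0, Real.log_exp]
      rw [hlog]
      ring
  have hvalue : (∫ z, fstar z * Real.log (fstar z / g z) ∂μ) + (∫ z, fstar z * α z ∂μ)
      = -(1 + ∑ j ∈ Finset.range (ne + nl + 1), lam j * H j) := by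
    rw [← integral_add hfstar_int1 hfstar_int2, integral_congr_ae (ae_of_all μ hpointwise),
      integral_neg, integral_add hf_int (integrable_finsetSum _ fun j hj =>
        (hint j hj).const_mul (lam j)), hfstar_pdf.2.2,
      integral_finsetSum _ fun j hj => (hint j hj).const_mul (lam j)]
    simp_rw [integral_const_mul]
    rw [Finset.sum_congr rfl hslack']
  refine ⟨hvalue, ?_⟩
  rw [hvalue, Finset.sum_filter_of_ne]
  intro j hj hne
  rcases le_or_gt j ne with hle | hlt
  · exact Or.inl hle
  · exact Or.inr ⟨hlt, mul_left_cancel₀ (left_ne_zero_of_mul hne) (hslack' j hj)⟩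
end

section
/- Weak duality for the constrained KL-minimization problem: In the constrained KL-minimization setup, let λ = (λ_0, λ_1, …, λ_m) ∈ ℝ^{m+1} be any vector with λ_j ≥ 0 for every j ∈ I, and assume ∫ g·exp( −(1 + α + Σ_{j=0}^{m} λ_j h_j) ) dμ < ∞. Then for every feasible pdf f with f = 0 μ-a.e. on {g = 0} and f log(f/g), f·α, and f·h_j (j = 0,…,m) integrable, one has L(f) ≥ −Σ_{j=0}^{m} λ_j H_j − ∫ g·exp( −(1 + α + Σ_{j=0}^{m} λ_j h_j) ) dμ. -/
open MeasureTheory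

/-- Fenchel–Young inequality for the entropy function relative to a weight `b`. -/
theorem neg_mul_le_mul_log_div_add_mul_exp {a b : ℝ} (s : ℝ) (ha : 0 ≤ a) (hb : 0 ≤ b)
    (hab : b = 0 → a = 0) :
    -(a * s) ≤ a * Real.log (a / b) + b * Real.exp (-(1 + s)) := by
  rcases ha.eq_or_lt with rfl | ha
  · simpa using mul_nonneg hb (Real.exp_pos _).le
  have hb : 0 < b := hb.lt_of_ne fun h0 => ha.ne' (hab h0.symm)
  have hexp : b * Real.exp (-(1 + s)) = a * Real.exp (-(1 + s) - Real.log (a / b)) := by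
    rw [Real.exp_sub, Real.exp_log (div_pos ha hb)]
    field_simp
  have := mul_le_mul_of_nonneg_left (Real.add_one_le_exp (-(1 + s) - Real.log (a / b))) ha.le
  rw [hexp]
  linarith

/-- Weak duality for the constrained KL-minimization problem. -/
theorem weak_duality
    {Ω : Type*} [MeasurableSpace Ω] (μ : Measure Ω) [SigmaFinite μ]
    (g : Ω → ℝ) (hg : IsPdf μ g)
    (α : Ω → ℝ) (hα : Measurable α)
    (ne nl : ℕ)
    (h : ℕ → Ω → ℝ) (H : ℕ → ℝ)
    (hh0 : h 0 = fun _ => 1) (hH0 : H 0 = 1)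
    (hh_meas : ∀ j ≤ ne + nl, Measurable (h j))
    (lam : ℕ → ℝ)
    (hlam_nonneg : ∀ j, ne < j → j ≤ ne + nl → 0 ≤ lam j)
    (htilt_int : Integrable (fun z =>
      g z * Real.exp (-(1 + α z + ∑ j ∈ Finset.range (ne + nl + 1), lam j * h j z))) μ)
    -- an arbitrary feasible pdf
    (f : Ω → ℝ) (hf : IsPdf μ f) (hf_feas : Feasible μ h H ne nl f)
    (habs : ∀ᵐ z ∂μ, g z = 0 → f z = 0)
    (hf_int1 : Integrable (fun z => f z * Real.log (f z / g z)) μ)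
    (hf_int2 : Integrable (fun z => f z * α z) μ)
    (hf_int3 : ∀ j ≤ ne + nl, Integrable (fun z => f z * h j z) μ) :
    (∫ z, f z * Real.log (f z / g z) ∂μ) + (∫ z, f z * α z ∂μ)
      ≥ -(∑ j ∈ Finset.range (ne + nl + 1), lam j * H j)
        - ∫ z, g z * Real.exp
            (-(1 + α z + ∑ j ∈ Finset.range (ne + nl + 1), lam j * h j z)) ∂μ := by
  have hsum_int : Integrable
      (fun z => ∑ j ∈ Finset.range (ne + nl + 1), lam j * (f z * h j z)) μ :=
    integrable_finsetSum _ fun j hj =>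
      (hf_int3 j (Nat.lt_succ_iff.mp (Finset.mem_range.mp hj))).const_mul _
  have hsum_le : ∫ z, ∑ j ∈ Finset.range (ne + nl + 1), lam j * (f z * h j z) ∂μ
      ≤ ∑ j ∈ Finset.range (ne + nl + 1), lam j * H j := by
    rw [integral_finsetSum _ fun j hj =>
      (hf_int3 j (Nat.lt_succ_iff.mp (Finset.mem_range.mp hj))).const_mul _]
    refine Finset.sum_le_sum fun j hj => ?_
    have hj : j ≤ ne + nl := Nat.lt_succ_iff.mp (Finset.mem_range.mp hj)
    rw [integral_const_mul]
    rcases le_or_gt j ne with hje | hje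
    · rw [(hf_feas.1 j hje).2]
    · exact mul_le_mul_of_nonneg_left (hf_feas.2 j hje hj).2 (hlam_nonneg j hje hj)
  have hpos : 0 ≤ ∫ z, (f z * Real.log (f z / g z) + f z * α z
      + ∑ j ∈ Finset.range (ne + nl + 1), lam j * (f z * h j z)
      + g z * Real.exp
        (-(1 + α z + ∑ j ∈ Finset.range (ne + nl + 1), lam j * h j z))) ∂μ := by
    refine integral_nonneg_of_ae ?_
    filter_upwards [hf.2.1, hg.2.1, habs] with z hfz hgz hfg
    have key := neg_mul_le_mul_log_div_add_mul_exp
      (α z + ∑ j ∈ Finset.range (ne + nl + 1), lam j * h j z) hfz hgz hfg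
    have hsum : ∑ j ∈ Finset.range (ne + nl + 1), lam j * (f z * h j z)
        = f z * ∑ j ∈ Finset.range (ne + nl + 1), lam j * h j z := by
      simp only [Finset.mul_sum, mul_left_comm]
    rw [← add_assoc] at key
    simp only [Pi.zero_apply, hsum]
    linarith
  rw [integral_add ((hf_int1.fun_add hf_int2).fun_add hsum_int) htilt_int,
    integral_add (hf_int1.fun_add hf_int2) hsum_int, integral_add hf_int1 hf_int2] at hpos
  linarith
end
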